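/- For every t ∈ [t₀,T], the map y ↦ Y^{t₀,y}(t) from E to E is twice Fréchet differentiable, and its second derivative y ↦ D²Y^{t₀,y}(t) is α-Hölder continuous from E to the space of bounded bilinear maps E × E → E. -/

import Mathlib

open MeasureTheory

/-- Operator spaces are equipped with the Borel σ-algebra of the norm topology. -/
noncomputable instance (priority := 100) {E F : Type*} [NormedAddCommGroup E]
    [NormedSpace ℝ E] [NormedAddCommGroup F] [NormedSpace ℝ F] :
    MeasurableSpace (E →L[ℝ] F) := borel _

/-- A function `[t₀,T] → E` which is measurable and bounded. -/
def BddMeasOn {E : Type u} [NormedAddCommGroup E] [MeasurableSpace E]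
    (f : ℝ → E) (t₀ T : ℝ) : Prop :=
  Measurable (fun t : Set.Icc t₀ T => f t) ∧ ∃ M, ∀ t ∈ Set.Icc t₀ T, ‖f t‖ ≤ M

/-- `Y` is a mild solution on `[t₀,T]` of `dY = AY dt + B(t,Y) dt + dz`. -/
def IsMildSolution {E : Type u} [NormedAddCommGroup E] [NormedSpace ℝ E]
    (S : ℝ → E →L[ℝ] E) (B : ℝ → E → E) (t₀ T : ℝ)
    (y : E) (z : ℝ → E) (Y : ℝ → E) : Prop :=
  ∀ t ∈ Set.Icc t₀ T,
    Y t = S (t - t₀) y + (∫ s in t₀..t, S (t - s) (B s (Y s))) + z t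

/-- A standard Borel space all of whose subsets are measurable is countable. -/
theorem countable_of_forall_measurableSet {X : Type*} [MeasurableSpace X] [StandardBorelSpace X]
    (h : ∀ s : Set X, MeasurableSet s) : Countable X := by
  by_contra hX
  have e := PolishSpace.measurableEquivNatBoolOfNotCountable hX
  have hall (s : Set (ℕ → Bool)) : MeasurableSet s := by
    simpa using e.symm.measurable (h (e ⁻¹' s))
  obtain ⟨b, hb, hgen⟩ :=
    (inferInstance : MeasurableSpace.CountablyGenerated (ℕ → Bool)).isCountablyGenerated
  have hcard := MeasurableSpace.cardinal_measurableSet_le_continuum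
    (hb.le_aleph0.trans Cardinal.aleph0_le_continuum)
  rw [← hgen] at hcard
  have huniv : {t : Set (ℕ → Bool) | MeasurableSet t} = Set.univ := Set.eq_univ_of_forall hall
  rw [huniv, Cardinal.mk_univ, Cardinal.mk_set] at hcard
  have : Cardinal.mk (ℕ → Bool) = Cardinal.continuum := by simp
  rw [this] at hcard
  exact absurd hcard (not_le.2 (Cardinal.cantor _))

/-- An idempotent map of a standard Borel space for which all preimages are measurable has
countable range. -/
theorem countable_range_of_idempotent {X : Type*} [MeasurableSpace X] [StandardBorelSpace X]
    {φ : X → X} (hφ : ∀ x, φ (φ x) = φ x) (h : ∀ s, MeasurableSet (φ ⁻¹' s)) :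
    (Set.range φ).Countable := by
  have hmeas : Measurable φ := fun s _ => h s
  have hrange : Set.range φ = {x | φ x = x} :=
    Set.ext fun x => ⟨by rintro ⟨y, rfl⟩; exact hφ y, fun hx => ⟨x, hx⟩⟩
  let := upgradeStandardBorel X
  have hR : MeasurableSet (Set.range φ) := hrange ▸ measurableSet_eq_fun hmeas measurable_id
  have := hR.standardBorel
  refine Set.countable_coe_iff.1 (countable_of_forall_measurableSet fun s => ?_)
  have hs : s = Subtype.val ⁻¹' (φ ⁻¹' (Subtype.val '' s)) := by
    ext ⟨x, hx⟩
    have hfix : φ x = x := by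
      obtain ⟨y, rfl⟩ := hx
      exact hφ y
    simp only [Set.mem_preimage, hfix, Set.mem_image, Subtype.exists, exists_and_right,
      exists_eq_right]
    exact ⟨fun h => ⟨hx, h⟩, fun ⟨_, h⟩ => h⟩
  rw [hs]
  exact measurable_subtype_coe (h _)

/-- A separated set of values of a Borel map on a standard Borel space is countable. -/
theorem countable_of_separated_of_subset_range {X F : Type*} [MeasurableSpace X]
    [StandardBorelSpace X] [PseudoEMetricSpace F] [MeasurableSpace F] [OpensMeasurableSpace F]
    {f : X → F} (hf : Measurable f) {D : Set F} (hD : D ⊆ Set.range f) {ε : ENNReal}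
    (hε : 0 < ε) (hsep : Metric.IsSeparated ε D) : D.Countable := by
  classical
  rcases D.eq_empty_or_nonempty with rfl | ⟨d₀, hd₀⟩
  · exact Set.countable_empty
  have : Nonempty X := ⟨(hD hd₀).choose⟩
  choose! σ hσ using fun d (hd : d ∈ D) => hD hd
  have huniq {x : F} {d d' : F} (hd : d ∈ D) (hd' : d' ∈ D) (h : edist x d < ε / 2)
      (h' : edist x d' < ε / 2) : d = d' := by
    by_contra hne
    refine absurd (hsep hd hd' hne) (not_lt.2 ?_)
    calc edist d d' ≤ edist d x + edist x d' := edist_triangle _ _ _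
      _ ≤ ε / 2 + ε / 2 := by rw [edist_comm d x]; gcongr
      _ = ε := ENNReal.add_halves ε
  let q : X → F := fun x => if h : ∃ d ∈ D, edist (f x) d < ε / 2 then h.choose else d₀
  have hq {x : X} {d : F} (hd : d ∈ D) (h : edist (f x) d < ε / 2) : q x = d := by
    have hex : ∃ d ∈ D, edist (f x) d < ε / 2 := ⟨d, hd, h⟩
    simp only [q, dif_pos hex]
    exact huniq hex.choose_spec.1 hd hex.choose_spec.2 h
  have hqD (x : X) : q x ∈ D := by
    by_cases hex : ∃ d ∈ D, edist (f x) d < ε / 2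
    · simp only [q, dif_pos hex]
      exact hex.choose_spec.1
    · simpa only [q, dif_neg hex]
  have hqσ {d : F} (hd : d ∈ D) : q (σ d) = d := by
    refine hq hd ?_
    rw [hσ d hd, edist_self]
    exact ENNReal.half_pos hε.ne'
  have hballs (C : Set F) : MeasurableSet (f ⁻¹' ⋃ d ∈ C, Metric.eball d (ε / 2)) :=
    hf (isOpen_biUnion fun _ _ => Metric.isOpen_eball).measurableSet
  have hqmeas (s : Set F) : MeasurableSet (q ⁻¹' s) := by
    have hsplit : q ⁻¹' s = (f ⁻¹' ⋃ d ∈ D ∩ s, Metric.eball d (ε / 2)) ∪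
        ((f ⁻¹' ⋃ d ∈ D, Metric.eball d (ε / 2))ᶜ ∩ {_x | d₀ ∈ s}) := by
      ext x
      by_cases hex : ∃ d ∈ D, edist (f x) d < ε / 2
      · obtain ⟨d, hd, hxd⟩ := hex
        have hmem : f x ∈ ⋃ d ∈ D, Metric.eball d (ε / 2) := Set.mem_biUnion hd hxd
        simp only [Set.mem_preimage, hq hd hxd, Set.mem_union, Set.mem_inter_iff,
          Set.mem_compl_iff, hmem, not_true, false_and, or_false, Set.mem_iUnion₂]
        refine ⟨fun h => ⟨d, ⟨hd, h⟩, hxd⟩, ?_⟩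
        rintro ⟨d', ⟨hd', hs'⟩, hxd'⟩
        rwa [huniq hd hd' hxd hxd']
      · have hx : q x = d₀ := by simp only [q, dif_neg hex]
        push Not at hex
        simp only [Set.mem_preimage, hx, Set.mem_union, Set.mem_inter_iff, Set.mem_compl_iff,
          Set.mem_iUnion₂, Metric.mem_eball, Set.mem_ofPred_eq]
        constructor
        · intro h
          exact Or.inr ⟨fun ⟨d, hd, hlt⟩ => absurd hlt (not_lt.2 (hex d hd)), h⟩
        · rintro (⟨d, hd, hlt⟩ | h)
          · exact absurd hlt (not_lt.2 (hex d hd.1))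
          · exact h.2
    rw [hsplit]
    exact (hballs _).union ((hballs _).compl.inter (MeasurableSet.const _))
  have hcount := countable_range_of_idempotent (φ := σ ∘ q)
    (fun x => by simp [hqσ (hqD x)]) (fun s => hqmeas (σ ⁻¹' s))
  have hsub : D ⊆ q '' Set.range (σ ∘ q) :=
    fun d hd => ⟨σ d, ⟨σ d, by simp [hqσ hd]⟩, hqσ hd⟩
  exact (hcount.image q).mono hsub

/-- A Borel map from a standard Borel space to a metric space has separable range; hence it is
strongly measurable, even if the target is not second countable. -/
theorem Measurable.stronglyMeasurable_of_standardBorel {X F : Type*} [MeasurableSpace X]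
    [StandardBorelSpace X] [PseudoEMetricSpace F] [MeasurableSpace F] [BorelSpace F]
    {f : X → F} (hf : Measurable f) : StronglyMeasurable f := by
  refine stronglyMeasurable_iff_measurable_separable.2 ⟨hf, ?_⟩
  obtain ⟨t, -, htc, ht⟩ := EMetric.subset_countable_closure_of_almost_dense_set (Set.range f)
    fun ε hε => by
      obtain ⟨D, hD⟩ := zorn_subset {D | D ⊆ Set.range f ∧ Metric.IsSeparated ε D}
        fun c hc hchain => ⟨⋃₀ c, ⟨Set.sUnion_subset fun s hs => (hc hs).1,
          (Set.pairwise_sUnion hchain.directedOn).2 fun s hs => (hc hs).2⟩,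
          fun s hs => Set.subset_sUnion_of_mem hs⟩
      refine ⟨D, countable_of_separated_of_subset_range hf hD.prop.1 hε hD.prop.2, ?_⟩
      intro y hy
      by_contra hcon
      simp only [Set.mem_iUnion₂, Metric.mem_closedEBall, not_exists, not_le] at hcon
      have hsub : insert y D ⊆ D := hD.2
        ⟨Set.insert_subset hy hD.prop.1, hD.prop.2.insert fun d hd _ => hcon d hd⟩
        (Set.subset_insert y D)
      simpa using (hcon y (hsub (Set.mem_insert y D))).trans_le (edist_self y).le
  exact ⟨t, htc, ht⟩

/-- Bounded and globally `α`-Hölder continuous functions between normed spaces. -/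
def BoundedHolder {P F : Type*} [NormedAddCommGroup P] [NormedAddCommGroup F] (α : ℝ)
    (f : P → F) : Prop :=
  ∃ C, (∀ p, ‖f p‖ ≤ C) ∧ ∀ p q, ‖f p - f q‖ ≤ C * ‖p - q‖ ^ α

namespace BoundedHolder

variable {P Q F G H : Type*} [NormedAddCommGroup P] [NormedAddCommGroup Q]
  [NormedAddCommGroup F] [NormedAddCommGroup G] [NormedSpace ℝ G]
  [NormedAddCommGroup H] [NormedSpace ℝ H] {α : ℝ} {f : P → F} {g : P → G}

theorem of_bounds {C K : ℝ} (hC : ∀ p, ‖f p‖ ≤ C)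
    (hK : ∀ p q, ‖f p - f q‖ ≤ K * ‖p - q‖ ^ α) : BoundedHolder α f :=
  ⟨max C K, fun p => (hC p).trans (le_max_left _ _), fun p q => (hK p q).trans
    (mul_le_mul_of_nonneg_right (le_max_right _ _) (Real.rpow_nonneg (norm_nonneg _) _))⟩

theorem of_lipschitz (hα : α ∈ Set.Ioo (0 : ℝ) 1) {C K : ℝ} (hC : ∀ p, ‖f p‖ ≤ C)
    (hK : ∀ p q, ‖f p - f q‖ ≤ K * ‖p - q‖) : BoundedHolder α f := by
  have hC0 : 0 ≤ C := (norm_nonneg _).trans (hC 0)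
  refine of_bounds (K := max K (2 * C)) hC fun p q => ?_
  rcases le_total ‖p - q‖ 1 with h | h
  · calc ‖f p - f q‖ ≤ K * ‖p - q‖ := hK p q
      _ ≤ max K (2 * C) * ‖p - q‖ := by gcongr; exact le_max_left _ _
      _ ≤ max K (2 * C) * ‖p - q‖ ^ α := by
        have : 0 ≤ max K (2 * C) := le_max_of_le_right (by positivity)
        gcongr
        exact Real.self_le_rpow_of_le_one (norm_nonneg _) h hα.2.le
  · calc ‖f p - f q‖ ≤ ‖f p‖ + ‖f q‖ := norm_sub_le _ _
      _ ≤ 2 * C := by linarith [hC p, hC q]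
      _ ≤ max K (2 * C) * 1 := by simp
      _ ≤ max K (2 * C) * ‖p - q‖ ^ α := by
        have : 0 ≤ max K (2 * C) := le_max_of_le_right (by positivity)
        gcongr
        exact Real.one_le_rpow h hα.1.le

theorem comp_lipschitz (hf : BoundedHolder α f) (hα : 0 ≤ α) {u : Q → P} {K : ℝ}
    (hu : ∀ p q, ‖u p - u q‖ ≤ K * ‖p - q‖) : BoundedHolder α fun q => f (u q) := by
  obtain ⟨C, hC, hH⟩ := hf
  have hC0 : 0 ≤ C := (norm_nonneg _).trans (hC 0)
  refine of_bounds (K := C * |K| ^ α) (fun p => hC _) fun p q => ?_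
  calc ‖f (u p) - f (u q)‖ ≤ C * ‖u p - u q‖ ^ α := hH _ _
    _ ≤ C * (|K| * ‖p - q‖) ^ α := by
      gcongr
      exact (hu p q).trans (by gcongr; exact le_abs_self K)
    _ = C * |K| ^ α * ‖p - q‖ ^ α := by
      rw [Real.mul_rpow (abs_nonneg _) (norm_nonneg _), mul_assoc]

theorem neg (hf : BoundedHolder α f) : BoundedHolder α fun p => -f p := by
  obtain ⟨C, hC, hH⟩ := hf
  refine ⟨C, fun p => ?_, fun p q => ?_⟩
  · rw [norm_neg]
    exact hC p
  · rw [neg_sub_neg, norm_sub_rev]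
    exact hH p q

variable [NormedSpace ℝ F]

theorem clm_apply (hf : BoundedHolder α f) (L : F →L[ℝ] G) : BoundedHolder α fun p => L (f p) := by
  obtain ⟨C, hC, hH⟩ := hf
  refine ⟨‖L‖ * C, fun p => L.le_of_opNorm_le_of_le le_rfl (hC p), fun p q => ?_⟩
  rw [← map_sub, mul_assoc]
  exact L.le_of_opNorm_le_of_le le_rfl (hH p q)

theorem bilin_apply (hf : BoundedHolder α f) (hg : BoundedHolder α g) (L : F →L[ℝ] G →L[ℝ] H) :
    BoundedHolder α fun p => L (f p) (g p) := by
  obtain ⟨C, hC, hH⟩ := hf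
  obtain ⟨C', hC', hH'⟩ := hg
  have hC0 : 0 ≤ C := (norm_nonneg _).trans (hC 0)
  have hC0' : 0 ≤ C' := (norm_nonneg _).trans (hC' 0)
  refine of_bounds (C := ‖L‖ * C * C') (K := 2 * (‖L‖ * C * C')) (fun p => ?_) fun p q => ?_
  · exact (L.le_opNorm₂ _ _).trans (by gcongr; exacts [hC p, hC' p])
  · calc ‖L (f p) (g p) - L (f q) (g q)‖
        = ‖L (f p - f q) (g p) + L (f q) (g p - g q)‖ := by simp
      _ ≤ ‖L‖ * ‖f p - f q‖ * ‖g p‖ + ‖L‖ * ‖f q‖ * ‖g p - g q‖ :=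
        norm_add_le_of_le (L.le_opNorm₂ _ _) (L.le_opNorm₂ _ _)
      _ ≤ ‖L‖ * (C * ‖p - q‖ ^ α) * C' + ‖L‖ * C * (C' * ‖p - q‖ ^ α) := by
        gcongr
        exacts [hH p q, hC' p, hC q, hH' p q]
      _ = 2 * (‖L‖ * C * C') * ‖p - q‖ ^ α := by ring

theorem comp {f : P → F →L[ℝ] G} {g : P → H →L[ℝ] F} (hf : BoundedHolder α f)
    (hg : BoundedHolder α g) : BoundedHolder α fun p => f p ∘L g p :=
  hf.bilin_apply (H := H →L[ℝ] G) hg (ContinuousLinearMap.compL ℝ H F G)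

theorem clm_comp {f : P → F →L[ℝ] G} (hf : BoundedHolder α f) (L : G →L[ℝ] H) :
    BoundedHolder α fun p => L ∘L f p :=
  hf.clm_apply (ContinuousLinearMap.compL ℝ F G H L)

theorem comp_clm {f : P → F →L[ℝ] G} (hf : BoundedHolder α f) (L : H →L[ℝ] F) :
    BoundedHolder α fun p => f p ∘L L :=
  hf.clm_apply ((ContinuousLinearMap.compL ℝ H F G).flip L)

end BoundedHolder

theorem lipschitz_of_hasFDerivAt_bound {P F : Type*} [NormedAddCommGroup P] [NormedSpace ℝ P]
    [NormedAddCommGroup F] [NormedSpace ℝ F] {f : P → F} {f' : P → P →L[ℝ] F} {C : ℝ}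
    (hf : ∀ p, HasFDerivAt f (f' p) p) (hC : ∀ p, ‖f' p‖ ≤ C) (p q : P) :
    ‖f p - f q‖ ≤ C * ‖p - q‖ :=
  convex_univ.norm_image_sub_le_of_norm_hasFDerivWithin_le
    (fun x _ => (hf x).hasFDerivWithinAt) (fun x _ => hC x) (Set.mem_univ q) (Set.mem_univ p)

section Inverse

variable {P A : Type*} [NormedAddCommGroup P] [NormedSpace ℝ P] [NormedRing A] [NormedAlgebra ℝ A]
  {f : P → A} {f' : P → P →L[ℝ] A} {C K α : ℝ}

theorem hasFDerivAt_inverse_comp [CompleteSpace A] (hf : ∀ p, HasFDerivAt f (f' p) p)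
    (hunit : ∀ p, IsUnit (f p))
    (p : P) : HasFDerivAt (fun p => Ring.inverse (f p))
      (-(ContinuousLinearMap.mulLeftRight ℝ A (Ring.inverse (f p)) (Ring.inverse (f p)) ∘L f' p))
      p := by
  obtain ⟨U, hU⟩ := hunit p
  have h := hasFDerivAt_ringInverse (𝕜 := ℝ) U
  rw [← Ring.inverse_unit, hU] at h
  exact h.comp p (hf p)

theorem BoundedHolder.inverse_comp [CompleteSpace A] (hα : α ∈ Set.Ioo (0 : ℝ) 1)
    (hf : ∀ p, HasFDerivAt f (f' p) p) (hunit : ∀ p, IsUnit (f p))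
    (hC : ∀ p, ‖Ring.inverse (f p)‖ ≤ C) (hK : ∀ p, ‖f' p‖ ≤ K) :
    BoundedHolder α fun p => Ring.inverse (f p) := by
  have hC0 : 0 ≤ C := (norm_nonneg _).trans (hC 0)
  refine .of_lipschitz hα hC (lipschitz_of_hasFDerivAt_bound (C := C * C * K)
    (hasFDerivAt_inverse_comp hf hunit) fun p => ?_)
  rw [norm_neg]
  refine (ContinuousLinearMap.opNorm_comp_le _ _).trans ?_
  gcongr
  · refine (ContinuousLinearMap.opNorm_mulLeftRight_apply_apply_le ℝ _ _ _).trans ?_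
    gcongr <;> exact hC p
  · exact hK p

theorem BoundedHolder.deriv_inverse_comp {g : P → A} (hg : BoundedHolder α g)
    (hf' : BoundedHolder α f') :
    BoundedHolder α fun p => -(ContinuousLinearMap.mulLeftRight ℝ A (g p) (g p) ∘L f' p) := by
  have h := (hg.bilin_apply (H := A →L[ℝ] A) hg
    (ContinuousLinearMap.mulLeftRight ℝ A)).bilin_apply hf' (ContinuousLinearMap.compL ℝ P A A)
  exact h.neg

end Inverse

section FixedPoint

variable {P X : Type*} [NormedAddCommGroup P] [NormedSpace ℝ P] [NormedAddCommGroup X]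
  [NormedSpace ℝ X]

theorem isUnit_one_sub_of_norm_le_half [CompleteSpace X] {A : X →L[ℝ] X} (hA : ‖A‖ ≤ 1 / 2) :
    IsUnit (1 - A) :=
  (Units.oneSub A (hA.trans_lt (by norm_num))).isUnit

theorem norm_inverse_one_sub_le_two [CompleteSpace X] {A : X →L[ℝ] X} (hA : ‖A‖ ≤ 1 / 2) :
    ‖Ring.inverse (1 - A)‖ ≤ 2 := by
  have h := Ring.mul_inverse_cancel _ (isUnit_one_sub_of_norm_le_half hA)
  rw [sub_mul, one_mul, sub_eq_iff_eq_add] at h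
  have h1 : ‖(1 : X →L[ℝ] X)‖ ≤ 1 := ContinuousLinearMap.norm_id_le
  have h2 := norm_add_le (1 : X →L[ℝ] X) (A * Ring.inverse (1 - A))
  rw [← h] at h2
  have h3 : ‖A * Ring.inverse (1 - A)‖ ≤ 1 / 2 * ‖Ring.inverse (1 - A)‖ :=
    (norm_mul_le _ _).trans (by gcongr)
  linarith

theorem lipschitz_of_fixedPoint {Ψ : X → X} (hΨ : ∀ v w, ‖Ψ v - Ψ w‖ ≤ 1 / 2 * ‖v - w‖)
    (L : P →L[ℝ] X) (c : X) {u : P → X} (hu : ∀ p, u p = L p + Ψ (u p) + c) (p q : P) :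
    ‖u p - u q‖ ≤ 2 * ‖L‖ * ‖p - q‖ := by
  have h1 : u p - u q = L (p - q) + (Ψ (u p) - Ψ (u q)) := by
    conv_lhs => rw [hu p, hu q]
    rw [map_sub]
    abel
  have h2 := norm_add_le_of_le (L.le_opNorm (p - q)) (hΨ (u p) (u q))
  rw [← h1] at h2
  linarith

theorem hasFDerivAt_of_fixedPoint [CompleteSpace X] {Ψ : X → X} {Ψ' : X → X →L[ℝ] X}
    (hΨ : ∀ v w, ‖Ψ v - Ψ w‖ ≤ 1 / 2 * ‖v - w‖) (hΨ' : ∀ v, HasFDerivAt Ψ (Ψ' v) v)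
    (L : P →L[ℝ] X) (c : X) {u : P → X} (hu : ∀ p, u p = L p + Ψ (u p) + c) (p : P) :
    HasFDerivAt u (Ring.inverse (1 - Ψ' (u p)) ∘L L) p := by
  have hA : ‖Ψ' (u p)‖ ≤ 1 / 2 :=
    (hΨ' _).le_of_lip' (by norm_num) (.of_forall fun w => hΨ w _)
  have hucont : Continuous u :=
    (LipschitzWith.of_dist_le' (K := 2 * ‖L‖) fun p q => by
      simpa only [dist_eq_norm] using lipschitz_of_fixedPoint hΨ L c hu p q).continuous
  have hG : HasFDerivAt (fun v => v - Ψ v) (1 - Ψ' (u p)) (u p) :=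
    (hasFDerivAt_id (u p)).sub (hΨ' (u p))
  have hcomp : HasFDerivAt (fun p => L p + c) L p := L.hasFDerivAt.add_const c
  refine hG.of_comp_of_leftInverse hucont.continuousAt hcomp (.of_forall fun q => ?_) fun x => ?_
  · have := hu q
    simp only [Function.comp]
    nth_rewrite 1 [this]
    abel
  · exact congrArg (fun A : X →L[ℝ] X => A x)
      (Ring.inverse_mul_cancel _ (isUnit_one_sub_of_norm_le_half hA))

/-- The solution of the fixed point equation `u = L p + Ψ u + c`, with `Ψ` a contraction which is
twice differentiable with bounded Hölder second derivative, depends on the parameter `p` in the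
same way. -/
theorem exists_hasFDerivAt_of_fixedPoint [CompleteSpace X] {α : ℝ}
    (hα : α ∈ Set.Ioo (0 : ℝ) 1) {Ψ : X → X} {Ψ' : X → X →L[ℝ] X} {Ψ'' : X → X →L[ℝ] X →L[ℝ] X}
    (hΨ : ∀ v w, ‖Ψ v - Ψ w‖ ≤ 1 / 2 * ‖v - w‖)
    (hΨ' : ∀ v, HasFDerivAt Ψ (Ψ' v) v) (hΨ'' : ∀ v, HasFDerivAt Ψ' (Ψ'' v) v)
    (hH : BoundedHolder α Ψ'') (L : P →L[ℝ] X) (c : X) {u : P → X}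
    (hu : ∀ p, u p = L p + Ψ (u p) + c) :
    ∃ (Du : P → P →L[ℝ] X) (D2u : P → P →L[ℝ] P →L[ℝ] X),
      (∀ p, HasFDerivAt u (Du p) p) ∧ (∀ p, HasFDerivAt Du (D2u p) p) ∧ BoundedHolder α D2u := by
  have hA (v : X) : ‖Ψ' v‖ ≤ 1 / 2 :=
    (hΨ' v).le_of_lip' (by norm_num) (.of_forall fun w => hΨ w v)
  have hunit (p : P) : IsUnit (1 - Ψ' (u p)) := isUnit_one_sub_of_norm_le_half (hA _)
  have huL := lipschitz_of_fixedPoint hΨ L c hu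
  have hRle (p : P) : ‖Ring.inverse (1 - Ψ' (u p))‖ ≤ 2 := norm_inverse_one_sub_le_two (hA _)
  have hDu := hasFDerivAt_of_fixedPoint hΨ hΨ' L c hu
  have hf (p : P) : HasFDerivAt (fun p => 1 - Ψ' (u p))
      (-(Ψ'' (u p) ∘L (Ring.inverse (1 - Ψ' (u p)) ∘L L))) p :=
    ((hΨ'' (u p)).comp p (hDu p)).const_sub 1
  obtain ⟨M, hM, -⟩ := id hH
  have hM0 : 0 ≤ M := (norm_nonneg (Ψ'' 0)).trans (hM 0)
  have hK (p : P) : ‖-(Ψ'' (u p) ∘L (Ring.inverse (1 - Ψ' (u p)) ∘L L))‖ ≤ M * (2 * ‖L‖) := by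
    refine (norm_neg (E := P →L[ℝ] X →L[ℝ] X) _).trans_le ?_
    refine (ContinuousLinearMap.opNorm_comp_le _ _).trans ?_
    gcongr
    · exact hM _
    · refine (ContinuousLinearMap.opNorm_comp_le _ _).trans ?_
      gcongr
      exact hRle p
  have hR := BoundedHolder.inverse_comp hα hf hunit hRle hK
  have hDuH : BoundedHolder α fun p => Ring.inverse (1 - Ψ' (u p)) ∘L L := hR.comp_clm L
  have hcomp : BoundedHolder α fun p => Ψ'' (u p) ∘L (Ring.inverse (1 - Ψ' (u p)) ∘L L) :=
    (hH.comp_lipschitz hα.1.le huL).comp hDuH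
  have hR'H := hR.deriv_inverse_comp hcomp.neg
  let cL : (X →L[ℝ] X) →L[ℝ] (P →L[ℝ] X) := (ContinuousLinearMap.compL ℝ P X X).flip L
  have hD2u (p : P) := cL.hasFDerivAt.comp p (hasFDerivAt_inverse_comp hf hunit p)
  exact ⟨_, _, hDu, hD2u, hR'H.clm_comp cL⟩

end FixedPoint

section BddMeas

/-- Bounded strongly measurable functions, as a subspace of `ℓ^∞`. -/
def bddMeasSubmodule (Ω F : Type*) [MeasurableSpace Ω] [NormedAddCommGroup F] [NormedSpace ℝ F] :
    Submodule ℝ (lp (fun _ : Ω => F) ⊤) where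
  carrier := {f | StronglyMeasurable (f : Ω → F)}
  zero_mem' := stronglyMeasurable_zero
  add_mem' hf hg := StronglyMeasurable.add hf hg
  smul_mem' c _ hf := StronglyMeasurable.const_smul hf c

/-- The Banach space of bounded strongly measurable functions with the supremum norm. -/
def BddMeas (Ω F : Type*) [MeasurableSpace Ω] [NormedAddCommGroup F] [NormedSpace ℝ F] : Type _ :=
  bddMeasSubmodule Ω F

namespace BddMeas

variable {Ω E F G : Type*} [MeasurableSpace Ω] [NormedAddCommGroup E] [NormedSpace ℝ E]
  [NormedAddCommGroup F] [NormedSpace ℝ F] [NormedAddCommGroup G] [NormedSpace ℝ G]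

noncomputable instance : NormedAddCommGroup (BddMeas Ω F) :=
  inferInstanceAs (NormedAddCommGroup (bddMeasSubmodule Ω F))

noncomputable instance : NormedSpace ℝ (BddMeas Ω F) :=
  inferInstanceAs (NormedSpace ℝ (bddMeasSubmodule Ω F))

instance : CoeFun (BddMeas Ω F) fun _ => Ω → F := ⟨fun f => f.1.1⟩

theorem stronglyMeasurable (f : BddMeas Ω F) : StronglyMeasurable f := f.2

/-- A bounded strongly measurable function as an element of `BddMeas`. -/
def mk (f : Ω → F) (hf : StronglyMeasurable f) {C : ℝ} (hC : ∀ t, ‖f t‖ ≤ C) : BddMeas Ω F :=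
  ⟨⟨f, memℓp_infty ⟨C, by rintro _ ⟨t, rfl⟩; exact hC t⟩⟩, hf⟩

@[simp] theorem mk_apply (f : Ω → F) (hf : StronglyMeasurable f) {C : ℝ} (hC : ∀ t, ‖f t‖ ≤ C)
    (t : Ω) : mk f hf hC t = f t := rfl

@[ext] theorem ext {f g : BddMeas Ω F} (h : ∀ t, f t = g t) : f = g :=
  Subtype.ext (Subtype.ext (funext h))

@[simp] theorem add_apply (f g : BddMeas Ω F) (t : Ω) : (f + g) t = f t + g t := rfl

@[simp] theorem smul_apply (c : ℝ) (f : BddMeas Ω F) (t : Ω) : (c • f) t = c • f t := rfl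

theorem norm_apply_le (f : BddMeas Ω F) (t : Ω) : ‖f t‖ ≤ ‖f‖ :=
  lp.norm_apply_le_norm (by simp) f.1 t

theorem norm_le {f : BddMeas Ω F} {C : ℝ} (hC : 0 ≤ C) (h : ∀ t, ‖f t‖ ≤ C) : ‖f‖ ≤ C :=
  lp.norm_le_of_forall_le (f := f.1) hC h

/-- Evaluation at a point. -/
noncomputable def eval (t : Ω) : BddMeas Ω F →L[ℝ] F :=
  LinearMap.mkContinuous ⟨⟨fun f => f t, fun _ _ => rfl⟩, fun _ _ => rfl⟩ 1
    fun f => (f.norm_apply_le t).trans_eq (one_mul _).symm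

instance [CompleteSpace F] : CompleteSpace (BddMeas Ω F) := by
  have hclosed : IsClosed (bddMeasSubmodule Ω F : Set (lp (fun _ : Ω => F) ⊤)) := by
    refine IsSeqClosed.isClosed fun f g hf hfg => ?_
    refine stronglyMeasurable_of_tendsto Filter.atTop (fun n => hf n)
      (tendsto_pi_nhds.2 fun t => ?_)
    rw [tendsto_iff_norm_sub_tendsto_zero] at hfg ⊢
    exact squeeze_zero (fun _ => norm_nonneg _)
      (fun n => lp.norm_apply_le_norm (by simp) (f n - g) t) hfg
  exact IsComplete.completeSpace_coe hclosed.isComplete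

/-- Pointwise application of operators to vectors. -/
noncomputable def mul : BddMeas Ω (F →L[ℝ] G) →L[ℝ] BddMeas Ω F →L[ℝ] BddMeas Ω G :=
  LinearMap.mkContinuous₂
    (LinearMap.mk₂ ℝ
      (fun A f => mk (fun t => A t (f t))
        (isBoundedBilinearMap_apply.continuous.comp_stronglyMeasurable
          (A.stronglyMeasurable.prodMk f.stronglyMeasurable))
        fun t => (A t).le_of_opNorm_le_of_le (A.norm_apply_le t) (f.norm_apply_le t))
      (fun _ _ _ => by ext; simp) (fun _ _ _ => by ext; simp)
      (fun _ _ _ => by ext; simp) (fun _ _ _ => by ext; simp))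
    1 fun A f => norm_le (by positivity) fun t => by
      simpa using (A t).le_of_opNorm_le_of_le (A.norm_apply_le t) (f.norm_apply_le t)

/-- The superposition operator `u ↦ b(·, u(·))`. -/
def superposition (b : Ω → E → F) (hb : ∀ u : BddMeas Ω E, StronglyMeasurable fun t => b t (u t))
    {C : ℝ} (hC : ∀ t x, ‖b t x‖ ≤ C) (u : BddMeas Ω E) : BddMeas Ω F :=
  mk (fun t => b t (u t)) (hb u) fun t => hC t (u t)

@[simp] theorem superposition_apply (b : Ω → E → F)
    (hb : ∀ u : BddMeas Ω E, StronglyMeasurable fun t => b t (u t)) {C : ℝ}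
    (hC : ∀ t x, ‖b t x‖ ≤ C) (u : BddMeas Ω E) (t : Ω) :
    superposition b hb hC u t = b t (u t) := rfl

theorem hasFDerivAt_superposition {b : Ω → E → F} {b' : Ω → E → E →L[ℝ] F}
    (hb : ∀ u : BddMeas Ω E, StronglyMeasurable fun t => b t (u t))
    (hb' : ∀ u : BddMeas Ω E, StronglyMeasurable fun t => b' t (u t))
    {C C' K β : ℝ} (hβ : 0 < β) (hC : ∀ t x, ‖b t x‖ ≤ C) (hC' : ∀ t x, ‖b' t x‖ ≤ C')
    (hderiv : ∀ t x, HasFDerivAt (b t) (b' t x) x)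
    (hK : ∀ t x y, ‖b' t x - b' t y‖ ≤ K * ‖x - y‖ ^ β) (u : BddMeas Ω E) :
    HasFDerivAt (superposition b hb hC) (mul (superposition b' hb' hC' u)) u := by
  have hest (v : BddMeas Ω E) : ‖superposition b hb hC v - superposition b hb hC u -
      mul (superposition b' hb' hC' u) (v - u)‖ ≤ |K| * ‖v - u‖ ^ β * ‖v - u‖ := by
    refine norm_le (by positivity) fun t => ?_
    have hvu : ‖v t - u t‖ ≤ ‖v - u‖ := (v - u).norm_apply_le t
    have h := (convex_closedBall (u t) ‖v - u‖).norm_image_sub_le_of_norm_hasFDerivWithin_le'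
      (f := b t) (f' := b' t) (φ := b' t (u t)) (C := |K| * ‖v - u‖ ^ β)
      (fun x _ => (hderiv t x).hasFDerivWithinAt)
      (fun x hx => (hK t x (u t)).trans (by
        rw [mem_closedBall_iff_norm] at hx
        gcongr
        exact le_abs_self K))
      (x := u t) (y := v t) (Metric.mem_closedBall_self (norm_nonneg _))
      (by rwa [mem_closedBall_iff_norm])
    exact h.trans (by gcongr)
  refine .of_isLittleO (Asymptotics.isLittleO_iff.2 fun c hc => ?_)
  have hlim : Filter.Tendsto (fun v : BddMeas Ω E => |K| * ‖v - u‖ ^ β) (nhds u) (nhds 0) := by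
    have hcont : Continuous fun v : BddMeas Ω E => |K| * ‖v - u‖ ^ β :=
      continuous_const.mul ((continuous_id.sub continuous_const).norm.rpow_const
        fun _ => Or.inr hβ.le)
    simpa [Real.zero_rpow hβ.ne'] using hcont.tendsto u
  filter_upwards [hlim.eventually (gt_mem_nhds hc)] with v hv
  exact (hest v).trans (mul_le_mul_of_nonneg_right hv.le (norm_nonneg _))

theorem boundedHolder_superposition {b : Ω → E → F}
    (hb : ∀ u : BddMeas Ω E, StronglyMeasurable fun t => b t (u t))
    {C K α : ℝ} (hα : 0 ≤ α) (hC : ∀ t x, ‖b t x‖ ≤ C)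
    (hK : ∀ t x y, ‖b t x - b t y‖ ≤ K * ‖x - y‖ ^ α) :
    BoundedHolder α (superposition b hb hC) := by
  refine .of_bounds (C := |C|) (K := |K|)
    (fun u => norm_le (abs_nonneg _) fun t => (hC _ _).trans (le_abs_self C))
    fun u v => norm_le (by positivity) fun t => (hK _ _ _).trans ?_
  gcongr
  · exact le_abs_self K
  · exact (u - v).norm_apply_le t

/-- Multiplication by a bounded measurable scalar function. -/
noncomputable def smulCLM (φ : Ω → ℝ) (hφ : StronglyMeasurable φ) {C : ℝ} (hC : ∀ t, |φ t| ≤ C) :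
    BddMeas Ω F →L[ℝ] BddMeas Ω F :=
  mul (mk (fun t => φ t • ContinuousLinearMap.id ℝ F) (hφ.smul_const _) (C := C) fun t => by
    rw [norm_smul]
    exact (mul_le_of_le_one_right (norm_nonneg _) ContinuousLinearMap.norm_id_le).trans (hC t))

end BddMeas

end BddMeas

section Superposition

theorem exists_hasFDerivAt_comp_clm {W X Z V : Type*} [NormedAddCommGroup W] [NormedSpace ℝ W]
    [NormedAddCommGroup X] [NormedSpace ℝ X] [NormedAddCommGroup Z] [NormedSpace ℝ Z]
    [NormedAddCommGroup V] [NormedSpace ℝ V] {α : ℝ} (hα : 0 ≤ α) {N : X → Z}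
    {N' : X → X →L[ℝ] Z} {N'' : X → X →L[ℝ] X →L[ℝ] Z} (hN : ∀ v, HasFDerivAt N (N' v) v)
    (hN' : ∀ v, HasFDerivAt N' (N'' v) v) (hH : BoundedHolder α N'') (R : W →L[ℝ] X)
    (D : Z →L[ℝ] V) :
    ∃ (Ψ' : W → W →L[ℝ] V) (Ψ'' : W → W →L[ℝ] W →L[ℝ] V),
      (∀ v, HasFDerivAt (fun w => D (N (R w))) (Ψ' v) v) ∧ (∀ v, HasFDerivAt Ψ' (Ψ'' v) v) ∧
      BoundedHolder α Ψ'' := by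
  let cD : (W →L[ℝ] Z) →L[ℝ] (W →L[ℝ] V) := ContinuousLinearMap.compL ℝ W Z V D
  let cR : (X →L[ℝ] Z) →L[ℝ] (W →L[ℝ] Z) := (ContinuousLinearMap.compL ℝ W X Z).flip R
  have h1 (v : W) : HasFDerivAt (fun w => N (R w)) (N' (R v) ∘L R) v :=
    (hN (R v)).comp v R.hasFDerivAt
  have h2 (v : W) : HasFDerivAt (fun w => N' (R w)) (N'' (R v) ∘L R) v :=
    (hN' (R v)).comp v R.hasFDerivAt
  have hR : BoundedHolder α fun v => N'' (R v) :=
    hH.comp_lipschitz (K := ‖R‖) hα fun p q => by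
      rw [← map_sub]
      exact R.le_opNorm _
  exact ⟨fun v => D ∘L (N' (R v) ∘L R), fun v => (cD ∘L cR) ∘L (N'' (R v) ∘L R),
    fun v => D.hasFDerivAt.comp v (h1 v), fun v => (cD ∘L cR).hasFDerivAt.comp v (h2 v),
    (hR.comp_clm R).clm_comp (cD ∘L cR)⟩

theorem BddMeas.exists_hasFDerivAt_superposition {Ω E F : Type*} [MeasurableSpace Ω]
    [NormedAddCommGroup E] [NormedSpace ℝ E] [NormedAddCommGroup F] [NormedSpace ℝ F]
    {b : Ω → E → F} {b' : Ω → E → E →L[ℝ] F} {b'' : Ω → E → E →L[ℝ] E →L[ℝ] F}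
    (hb : ∀ u : BddMeas Ω E, StronglyMeasurable fun t => b t (u t))
    (hb' : ∀ u : BddMeas Ω E, StronglyMeasurable fun t => b' t (u t))
    (hb'' : ∀ u : BddMeas Ω E, StronglyMeasurable fun t => b'' t (u t))
    {C C' C'' K α : ℝ} (hα : 0 < α) (hC : ∀ t x, ‖b t x‖ ≤ C) (hC' : ∀ t x, ‖b' t x‖ ≤ C')
    (hC'' : ∀ t x, ‖b'' t x‖ ≤ C'') (hd : ∀ t x, HasFDerivAt (b t) (b' t x) x)
    (hd' : ∀ t x, HasFDerivAt (b' t) (b'' t x) x)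
    (hK : ∀ t x y, ‖b'' t x - b'' t y‖ ≤ K * ‖x - y‖ ^ α) :
    ∃ (N' : BddMeas Ω E → BddMeas Ω E →L[ℝ] BddMeas Ω F)
      (N'' : BddMeas Ω E → BddMeas Ω E →L[ℝ] BddMeas Ω E →L[ℝ] BddMeas Ω F),
      (∀ u, HasFDerivAt (superposition b hb hC) (N' u) u) ∧ (∀ u, HasFDerivAt N' (N'' u) u) ∧
      BoundedHolder α N'' := by
  have h1 (u) : HasFDerivAt (superposition b hb hC) (mul (superposition b' hb' hC' u)) u :=
    hasFDerivAt_superposition hb hb' one_pos hC hC' hd (K := C'') (fun t x y => by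
      rw [Real.rpow_one]
      exact lipschitz_of_hasFDerivAt_bound (hd' t) (hC'' t) x y) u
  have h2 (u) := hasFDerivAt_superposition hb' hb'' hα hC' hC'' hd' hK u
  have h3 : BoundedHolder α fun u => mul (superposition b'' hb'' hC'' u) :=
    (boundedHolder_superposition hb'' hα.le hC'' hK).clm_apply mul
  exact ⟨fun u => mul (superposition b' hb' hC' u),
    fun u => mul ∘L mul (superposition b'' hb'' hC'' u), h1,
    fun u => (mul (Ω := Ω) (F := E) (G := F)).hasFDerivAt.comp u (h2 u), h3.clm_comp mul⟩

end Superposition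

section Volterra

variable {E : Type*} [NormedAddCommGroup E] [NormedSpace ℝ E] {S : ℝ → E →L[ℝ] E} {C t₀ T : ℝ}

theorem norm_convolution_le (h₀ : 0 ≤ t₀) (hSC : ∀ t ∈ Set.Icc 0 T, ‖S t‖ ≤ C) {t s : ℝ}
    (ht : t ∈ Set.Icc t₀ T) (hs : s ∈ Set.Ioc t₀ t) (x : E) : ‖S (t - s) x‖ ≤ C * ‖x‖ :=
  (S (t - s)).le_of_opNorm_le
    (hSC _ ⟨sub_nonneg.2 hs.2, by linarith [hs.1, ht.2]⟩) x

variable [MeasurableSpace E] [BorelSpace E]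

theorem stronglyMeasurable_convolution (hS : Measurable fun p : ℝ × E => S p.1 p.2) {f : ℝ → E}
    (hf : Measurable f) : StronglyMeasurable fun p : ℝ × ℝ => S (p.1 - p.2) (f p.2) :=
  (hS.comp ((measurable_fst.sub measurable_snd).prodMk
    (hf.comp measurable_snd))).stronglyMeasurable_of_standardBorel

theorem intervalIntegrable_convolution (hS : Measurable fun p : ℝ × E => S p.1 p.2) (h₀ : 0 ≤ t₀)
    (hSC : ∀ t ∈ Set.Icc 0 T, ‖S t‖ ≤ C) (f : BddMeas ℝ E) {t : ℝ} (ht : t ∈ Set.Icc t₀ T) :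
    IntervalIntegrable (fun s => S (t - s) (f s)) volume t₀ t := by
  rw [intervalIntegrable_iff_integrableOn_Ioc_of_le ht.1]
  refine IntegrableOn.of_bound (C := C * ‖f‖) (by simp)
    ((stronglyMeasurable_convolution hS f.stronglyMeasurable.measurable).comp_measurable
      measurable_prodMk_left).aestronglyMeasurable ?_
  filter_upwards [ae_restrict_mem measurableSet_Ioc] with s hs
  have hC : 0 ≤ C := (norm_nonneg _).trans (hSC 0 ⟨le_rfl, h₀.trans (ht.1.trans ht.2)⟩)
  exact (norm_convolution_le h₀ hSC ht hs _).trans (by gcongr; exact f.norm_apply_le s)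

theorem stronglyMeasurable_indicator_integral_convolution
    (hS : Measurable fun p : ℝ × E => S p.1 p.2) {f : ℝ → E} (hf : Measurable f) (t₀ T : ℝ) :
    StronglyMeasurable
      ((Set.Icc t₀ T).indicator fun t => ∫ s in t₀..t, S (t - s) (f s)) := by
  have hset : MeasurableSet {p : ℝ × ℝ | t₀ < p.2 ∧ p.2 ≤ p.1} :=
    (measurableSet_lt measurable_const measurable_snd).inter
      (measurableSet_le measurable_snd measurable_fst)
  have hmeas := ((stronglyMeasurable_convolution hS hf).indicator hset).integral_prod_right'
    (ν := volume)
  convert hmeas.indicator (measurableSet_Icc (a := t₀) (b := T)) using 1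
  refine Set.indicator_congr fun t ht => ?_
  rw [intervalIntegral.integral_of_le ht.1, ← integral_indicator measurableSet_Ioc]
  rfl

/-- The Volterra operator `f ↦ ∫_{t₀}^t S(t-s) f(s) ds` on bounded measurable functions. -/
theorem exists_volterra (hS : Measurable fun p : ℝ × E => S p.1 p.2) (h₀ : 0 ≤ t₀) (hT : t₀ ≤ T)
    (hSC : ∀ t ∈ Set.Icc 0 T, ‖S t‖ ≤ C) :
    ∃ Λ : BddMeas ℝ E →L[ℝ] BddMeas ℝ E, ∀ f t,
      Λ f t = (Set.Icc t₀ T).indicator (fun t => ∫ s in t₀..t, S (t - s) (f s)) t := by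
  have hC : 0 ≤ C := (norm_nonneg _).trans (hSC 0 ⟨le_rfl, h₀.trans hT⟩)
  have hbound (f : BddMeas ℝ E) (t : ℝ) :
      ‖(Set.Icc t₀ T).indicator (fun t => ∫ s in t₀..t, S (t - s) (f s)) t‖
        ≤ C * (T - t₀) * ‖f‖ := by
    have hT' : 0 ≤ T - t₀ := sub_nonneg.2 hT
    by_cases ht : t ∈ Set.Icc t₀ T
    · rw [Set.indicator_of_mem ht]
      calc ‖∫ s in t₀..t, S (t - s) (f s)‖ ≤ C * ‖f‖ * |t - t₀| := by
            refine intervalIntegral.norm_integral_le_of_norm_le_const fun s hs => ?_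
            rw [Set.uIoc_of_le ht.1] at hs
            exact (norm_convolution_le h₀ hSC ht hs _).trans (by gcongr; exact f.norm_apply_le s)
        _ ≤ C * ‖f‖ * (T - t₀) := by
            rw [abs_of_nonneg (sub_nonneg.2 ht.1)]
            gcongr
            exact ht.2
        _ = C * (T - t₀) * ‖f‖ := by ring
    · rw [Set.indicator_of_notMem ht, norm_zero]
      positivity
  refine ⟨LinearMap.mkContinuous
    ⟨⟨fun f => .mk _ (stronglyMeasurable_indicator_integral_convolution hS
      f.stronglyMeasurable.measurable t₀ T) (hbound f), fun f g => ?_⟩, fun c f => ?_⟩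
    (C * (T - t₀)) fun f => BddMeas.norm_le (by have := sub_nonneg.2 hT; positivity) (hbound f),
    fun _ _ => rfl⟩
  · ext t
    by_cases ht : t ∈ Set.Icc t₀ T
    · simp only [BddMeas.mk_apply, BddMeas.add_apply, Set.indicator_of_mem ht, map_add]
      exact intervalIntegral.integral_add (intervalIntegrable_convolution hS h₀ hSC f ht)
        (intervalIntegrable_convolution hS h₀ hSC g ht)
    · simp [Set.indicator_of_notMem ht]
  · ext t
    by_cases ht : t ∈ Set.Icc t₀ T
    · simp only [BddMeas.mk_apply, BddMeas.smul_apply, Set.indicator_of_mem ht, map_smul,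
        RingHom.id_apply]
      exact intervalIntegral.integral_smul c _
    · simp [Set.indicator_of_notMem ht]

end Volterra

section WeightedNorm

theorem exp_mul_norm_integral_le {E : Type*} [NormedAddCommGroup E] [NormedSpace ℝ E] {g : ℝ → E}
    {l M t₀ t : ℝ} (hl : 0 < l) (hM : 0 ≤ M) (ht : t₀ ≤ t)
    (hg : ∀ s ∈ Set.Ioc t₀ t, ‖g s‖ ≤ M * Real.exp (l * (s - t₀))) :
    Real.exp (-(l * (t - t₀))) * ‖∫ s in t₀..t, g s‖ ≤ M / l := by
  have hcont : Continuous fun s => M * Real.exp (l * (s - t₀)) := by fun_prop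
  have hle := intervalIntegral.norm_integral_le_of_norm_le (μ := volume) ht
    (.of_forall fun s hs => hg s hs) (hcont.intervalIntegrable t₀ t)
  have hderiv (s : ℝ) : HasDerivAt (fun s => M / l * Real.exp (l * (s - t₀)))
      (M * Real.exp (l * (s - t₀))) s := by
    have := ((((hasDerivAt_id s).sub_const t₀).const_mul l).exp).const_mul (M / l)
    refine this.congr_deriv ?_
    change M / l * (Real.exp (l * (s - t₀)) * (l * 1)) = _
    field_simp
  rw [intervalIntegral.integral_eq_sub_of_hasDerivAt (fun s _ => hderiv s)
    (hcont.intervalIntegrable t₀ t), sub_self, mul_zero, Real.exp_zero, mul_one] at hle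
  have hMl : 0 ≤ M / l := by positivity
  calc Real.exp (-(l * (t - t₀))) * ‖∫ s in t₀..t, g s‖
      ≤ Real.exp (-(l * (t - t₀))) * (M / l * Real.exp (l * (t - t₀))) := by
        gcongr
        linarith
    _ = M / l := by
        rw [mul_left_comm, ← Real.exp_add, neg_add_cancel, Real.exp_zero, mul_one]

/-- The exponential weight `t ↦ exp (l (t - t₀))`, restricted to `[t₀,T]`. -/
noncomputable def expWeight (t₀ T l : ℝ) : ℝ → ℝ :=
  (Set.Icc t₀ T).indicator fun t => Real.exp (l * (t - t₀))

theorem expWeight_of_mem {t₀ T l t : ℝ} (ht : t ∈ Set.Icc t₀ T) :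
    expWeight t₀ T l t = Real.exp (l * (t - t₀)) :=
  Set.indicator_of_mem ht _

theorem stronglyMeasurable_expWeight (t₀ T l : ℝ) : StronglyMeasurable (expWeight t₀ T l) :=
  StronglyMeasurable.indicator (by fun_prop) measurableSet_Icc

theorem abs_expWeight_le (t₀ T l t : ℝ) : |expWeight t₀ T l t| ≤ Real.exp (|l| * (T - t₀)) := by
  by_cases ht : t ∈ Set.Icc t₀ T
  · rw [expWeight_of_mem ht, Real.abs_exp, Real.exp_le_exp]
    have := sub_nonneg.2 ht.1
    gcongr
    · exact le_abs_self l
    · exact ht.2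
  · simp [expWeight, Set.indicator_of_notMem ht, Real.exp_nonneg]

/-- Multiplication by the exponential weight. -/
noncomputable def expWeightCLM {E : Type*} [NormedAddCommGroup E] [NormedSpace ℝ E]
    (t₀ T l : ℝ) : BddMeas ℝ E →L[ℝ] BddMeas ℝ E :=
  BddMeas.smulCLM (expWeight t₀ T l) (stronglyMeasurable_expWeight t₀ T l) (abs_expWeight_le t₀ T l)

theorem expWeightCLM_apply {E : Type*} [NormedAddCommGroup E] [NormedSpace ℝ E]
    (t₀ T l : ℝ) (f : BddMeas ℝ E) (t : ℝ) :
    expWeightCLM t₀ T l f t = expWeight t₀ T l t • f t := rfl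

/-- In the exponentially weighted norm the integral operator of the mild equation contracts. -/
theorem norm_weighted_volterra_sub_le {E : Type*} [NormedAddCommGroup E] [NormedSpace ℝ E]
    [MeasurableSpace E] [BorelSpace E] {S : ℝ → E →L[ℝ] E} {C K t₀ T : ℝ} (h₀ : 0 ≤ t₀)
    (hC : 0 ≤ C) (hK : 0 ≤ K) (hSC : ∀ t ∈ Set.Icc 0 T, ‖S t‖ ≤ C)
    {Λ : BddMeas ℝ E →L[ℝ] BddMeas ℝ E} (hΛ : ∀ f t,
      Λ f t = (Set.Icc t₀ T).indicator (fun t => ∫ s in t₀..t, S (t - s) (f s)) t)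
    {N : BddMeas ℝ E → BddMeas ℝ E} (hN : ∀ u v t, ‖N u t - N v t‖ ≤ K * ‖u t - v t‖)
    (u v : BddMeas ℝ E) :
    ‖expWeightCLM t₀ T (-(2 * C * K + 1)) (Λ (N (expWeightCLM t₀ T (2 * C * K + 1) u))) -
      expWeightCLM t₀ T (-(2 * C * K + 1)) (Λ (N (expWeightCLM t₀ T (2 * C * K + 1) v)))‖
      ≤ 1 / 2 * ‖u - v‖ := by
  have hCK : 0 ≤ C * K := mul_nonneg hC hK
  set l := 2 * C * K + 1 with hl
  have hl0 : 0 < l := by rw [hl]; linarith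
  rw [← map_sub, ← map_sub]
  refine BddMeas.norm_le (by positivity) fun t => ?_
  rw [expWeightCLM_apply, hΛ]
  by_cases ht : t ∈ Set.Icc t₀ T
  · rw [Set.indicator_of_mem ht, expWeight_of_mem ht, norm_smul, Real.norm_eq_abs, Real.abs_exp,
      neg_mul]
    have hM : 0 ≤ C * K * ‖u - v‖ := by positivity
    refine (exp_mul_norm_integral_le hl0 hM ht.1 fun s hs => ?_).trans ?_
    · have hs' : s ∈ Set.Icc t₀ T := ⟨hs.1.le, hs.2.trans ht.2⟩
      refine (norm_convolution_le h₀ hSC ht hs _).trans ?_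
      rw [mul_assoc C, mul_assoc C, mul_assoc K]
      refine mul_le_mul_of_nonneg_left ((hN _ _ s).trans ?_) hC
      refine mul_le_mul_of_nonneg_left ?_ hK
      rw [expWeightCLM_apply, expWeightCLM_apply, ← smul_sub, norm_smul, expWeight_of_mem hs',
        Real.norm_eq_abs, Real.abs_exp, mul_comm]
      gcongr
      exact (u - v).norm_apply_le s
    · rw [div_le_iff₀ hl0, hl]
      nlinarith [norm_nonneg (u - v)]
  · rw [Set.indicator_of_notMem ht, smul_zero, norm_zero]
    positivity

end WeightedNorm

section InitialDatum

variable {E : Type*} [NormedAddCommGroup E] [NormedSpace ℝ E] [MeasurableSpace E] [BorelSpace E]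

theorem exists_initialDatum_clm {S : ℝ → E →L[ℝ] E} {C t₀ T : ℝ}
    (hS : Measurable fun p : ℝ × E => S p.1 p.2) (h₀ : 0 ≤ t₀) (hC : 0 ≤ C)
    (hSC : ∀ t ∈ Set.Icc 0 T, ‖S t‖ ≤ C) :
    ∃ L : E →L[ℝ] BddMeas ℝ E, ∀ y t,
      L y t = (Set.Icc t₀ T).indicator (fun t => S (t - t₀) y) t := by
  have hmeas (y : E) :
      StronglyMeasurable ((Set.Icc t₀ T).indicator fun t => S (t - t₀) y) :=
    ((hS.comp ((measurable_id.sub_const t₀).prodMk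
      measurable_const)).indicator measurableSet_Icc).stronglyMeasurable_of_standardBorel
  have hbound (y : E) (t : ℝ) : ‖(Set.Icc t₀ T).indicator (fun t => S (t - t₀) y) t‖ ≤ C * ‖y‖ := by
    by_cases ht : t ∈ Set.Icc t₀ T
    · rw [Set.indicator_of_mem ht]
      exact (S (t - t₀)).le_of_opNorm_le
        (hSC _ ⟨sub_nonneg.2 ht.1, by linarith [ht.2]⟩) y
    · rw [Set.indicator_of_notMem ht, norm_zero]
      positivity
  refine ⟨LinearMap.mkContinuous ⟨⟨fun y => .mk _ (hmeas y) (hbound y), fun x y => ?_⟩,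
    fun c y => ?_⟩ C fun y => BddMeas.norm_le (by positivity) (hbound y), fun _ _ => rfl⟩
  · ext t
    by_cases ht : t ∈ Set.Icc t₀ T <;> simp [ht]
  · ext t
    by_cases ht : t ∈ Set.Icc t₀ T <;> simp [ht]

theorem BddMeasOn.exists_bddMeas {f : ℝ → E} {t₀ T : ℝ} (hf : BddMeasOn f t₀ T) :
    ∃ g : BddMeas ℝ E, ∀ t, g t = (Set.Icc t₀ T).indicator f t := by
  obtain ⟨hmeas, M, hM⟩ := hf
  have hind : Measurable ((Set.Icc t₀ T).indicator f) := by
    refine measurable_of_restrict_of_restrict_compl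
      (measurableSet_Icc (a := t₀) (b := T)) ?_ ?_
    · convert hmeas using 1
      exact funext fun t => Set.indicator_of_mem t.2 f
    · convert measurable_const (a := (0 : E)) using 1
      exact funext fun t => Set.indicator_of_notMem t.2 f
  refine ⟨.mk _ hind.stronglyMeasurable_of_standardBorel (C := |M|) fun t => ?_, fun _ => rfl⟩
  by_cases ht : t ∈ Set.Icc t₀ T
  · rw [Set.indicator_of_mem ht]
    exact (hM t ht).trans (le_abs_self M)
  · simp [Set.indicator_of_notMem ht]

end InitialDatum

/-- For every `t ∈ [t₀,T]` the map `y ↦ Y^{t₀,y}(t)` is twice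
Fréchet differentiable, and its second derivative `y ↦ D²Y^{t₀,y}(t)` is `α`-Hölder
continuous from `E` to the bounded bilinear maps `E × E → E`. -/
theorem mild_solution_twice_differentiable_in_initial_datum
    {E : Type u} [NormedAddCommGroup E] [NormedSpace ℝ E] [CompleteSpace E]
    [MeasurableSpace E] [BorelSpace E]
    (T t₀ : ℝ) (hT : 0 < T) (ht₀ : t₀ ∈ Set.Ico (0:ℝ) T)
    (S : ℝ → E →L[ℝ] E) (C_A : ℝ)
    (hS0 : S 0 = ContinuousLinearMap.id ℝ E)
    (hSsemi : ∀ s t : ℝ, 0 ≤ s → 0 ≤ t → s + t ≤ T → (S t).comp (S s) = S (s + t))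
    (hSbd : ∀ t ∈ Set.Icc (0:ℝ) T, ‖S t‖ ≤ C_A)
    (hSmeas : Measurable fun p : ℝ × E => S p.1 p.2)
    (B : ℝ → E → E) (DB : ℝ → E → E →L[ℝ] E)
    (D2B : ℝ → E → E →L[ℝ] E →L[ℝ] E) (Bsup K_B M_B M_alpha α : ℝ)
    (hα : α ∈ Set.Ioo (0:ℝ) 1)
    (hBmeas : Measurable (Function.uncurry B))
    (hDBmeas : Measurable fun p : ℝ × E => DB p.1 p.2)
    (hD2Bmeas : Measurable fun p : ℝ × E => D2B p.1 p.2)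
    (hBbd : ∀ t x, ‖B t x‖ ≤ Bsup)
    (hDB : ∀ t x, HasFDerivAt (B t) (DB t x) x)
    (hDBbd : ∀ t x, ‖DB t x‖ ≤ K_B)
    (hD2B : ∀ t x, HasFDerivAt (fun w => DB t w) (D2B t x) x)
    (hD2Bbd : ∀ t x, ‖D2B t x‖ ≤ M_B)
    (hD2Bholder : ∀ t x x', ‖D2B t x - D2B t x'‖ ≤ M_alpha * ‖x - x'‖ ^ α)
    (z : ℝ → E) (hz : BddMeasOn z t₀ T)
    (Y : E → ℝ → E)
    (hY : ∀ y : E, BddMeasOn (Y y) t₀ T ∧ IsMildSolution S B t₀ T y z (Y y)) :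
    ∀ t ∈ Set.Icc t₀ T,
      ∃ (DY : E → E →L[ℝ] E) (D2Y : E → E →L[ℝ] E →L[ℝ] E),
        (∀ y : E, HasFDerivAt (fun w => Y w t) (DY y) y) ∧
        (∀ y : E, HasFDerivAt DY (D2Y y) y) ∧
        (∃ C : ℝ, ∀ y w : E, ‖D2Y y - D2Y w‖ ≤ C * ‖y - w‖ ^ α) := by
  have h₀ : 0 ≤ t₀ := ht₀.1
  have hC : 0 ≤ C_A := (norm_nonneg _).trans (hSbd 0 ⟨le_rfl, hT.le⟩)
  have hK : 0 ≤ K_B := (norm_nonneg _).trans (hDBbd 0 0)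
  have hmeas {F : Type u} [NormedAddCommGroup F] [MeasurableSpace F] [BorelSpace F]
      {b : ℝ → E → F} (hb : Measurable fun p : ℝ × E => b p.1 p.2) (u : BddMeas ℝ E) :
      StronglyMeasurable fun t => b t (u t) :=
    (hb.comp (measurable_id.prodMk
      u.stronglyMeasurable.measurable)).stronglyMeasurable_of_standardBorel
  obtain ⟨Λ, hΛ⟩ := exists_volterra hSmeas h₀ ht₀.2.le hSbd
  obtain ⟨L, hL⟩ := exists_initialDatum_clm hSmeas h₀ hC hSbd (t₀ := t₀)
  obtain ⟨c, hc⟩ := hz.exists_bddMeas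
  choose v hv using fun y => (hY y).1.exists_bddMeas
  let N : BddMeas ℝ E → BddMeas ℝ E := BddMeas.superposition B (hmeas hBmeas) hBbd
  obtain ⟨N', N'', hN', hN'', hH⟩ := BddMeas.exists_hasFDerivAt_superposition (hmeas hBmeas)
    (hmeas hDBmeas) (hmeas hD2Bmeas) hα.1 hBbd hDBbd hD2Bbd hDB hD2B hD2Bholder
  set l := 2 * C_A * K_B + 1 with hl
  let W : BddMeas ℝ E →L[ℝ] BddMeas ℝ E := expWeightCLM t₀ T l
  let W' : BddMeas ℝ E →L[ℝ] BddMeas ℝ E := expWeightCLM t₀ T (-l)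
  obtain ⟨Ψ', Ψ'', hΨ', hΨ'', hHΨ⟩ := exists_hasFDerivAt_comp_clm hα.1.le hN' hN'' hH W (W' ∘L Λ)
  have hΨ : ∀ u w, ‖(W' ∘L Λ) (N (W u)) - (W' ∘L Λ) (N (W w))‖ ≤ 1 / 2 * ‖u - w‖ :=
    norm_weighted_volterra_sub_le h₀ hC hK hSbd hΛ fun u w t =>
      lipschitz_of_hasFDerivAt_bound (hDB t) (hDBbd t) (u t) (w t)
  have hW {t : ℝ} (ht : t ∈ Set.Icc t₀ T) (y : E) :
      Real.exp (l * (t - t₀)) • W' (v y) t = Y y t := by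
    rw [expWeightCLM_apply, expWeight_of_mem ht, hv, Set.indicator_of_mem ht, smul_smul,
      ← Real.exp_add, neg_mul, add_neg_cancel, Real.exp_zero, one_smul]
  have hfix (y : E) : W' (v y) = (W' ∘L L) y + (W' ∘L Λ) (N (W (W' (v y)))) + W' c := by
    have hmild : v y = L y + Λ (N (W (W' (v y)))) + c := by
      ext t
      rw [BddMeas.add_apply, BddMeas.add_apply, hv, hL, hΛ, hc]
      by_cases ht : t ∈ Set.Icc t₀ T
      · simp only [Set.indicator_of_mem ht]
        rw [(hY y).2 t ht]
        congr 2
        refine intervalIntegral.integral_congr fun s hs => ?_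
        rw [Set.uIcc_of_le ht.1] at hs
        have hs' : s ∈ Set.Icc t₀ T := ⟨hs.1, hs.2.trans ht.2⟩
        have hWs : W (W' (v y)) s = Y y s := by
          rw [expWeightCLM_apply, expWeight_of_mem hs']
          exact hW hs' y
        simp only [N, BddMeas.superposition_apply, hWs]
      · simp [Set.indicator_of_notMem ht]
    conv_lhs => rw [hmild, map_add, map_add]
    rfl
  obtain ⟨Du, D2u, hDu, hD2u, hHu⟩ :=
    exists_hasFDerivAt_of_fixedPoint hα hΨ hΨ' hΨ'' hHΨ (W' ∘L L) (W' c) hfix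
  intro t ht
  let ev : BddMeas ℝ E →L[ℝ] E := Real.exp (l * (t - t₀)) • BddMeas.eval t
  let cev : (E →L[ℝ] BddMeas ℝ E) →L[ℝ] (E →L[ℝ] E) :=
    ContinuousLinearMap.compL ℝ E (BddMeas ℝ E) E ev
  have hYev : (fun w => Y w t) = fun w => ev (W' (v w)) := funext fun w => (hW ht w).symm
  obtain ⟨M, -, hM⟩ := hHu.clm_comp cev
  refine ⟨fun y => ev ∘L Du y, fun y => cev ∘L D2u y, fun y => ?_,
    fun y => cev.hasFDerivAt.comp y (hD2u y), M, hM⟩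
  rw [hYev]
  exact ev.hasFDerivAt.comp y (hDu y)
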